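/- Let f : {0,1}^n → {0,1} be a total Boolean function, let ε ∈ [0, 1/2), and let q : {0,1}^n → ℝ satisfy: q(x) ∈ [1−2ε, 1] whenever f(x) = 1 and q(x) ∈ [−1, −1+2ε] whenever f(x) = 0. Then λ(f) ≤ ‖B_q‖ / (1 − 2ε). -/

import Mathlib

noncomputable def specNorm {I : Type*} [Fintype I] [DecidableEq I] (A : Matrix I I ℝ) : ℝ :=
  ‖Matrix.toEuclideanCLM (𝕜 := ℝ) A‖

/-- Adjacency matrix of the sensitivity graph of `f`. -/
def sensAdj {I : Type*} [Fintype I] [DecidableEq I] (f : (I → Bool) → Bool) :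
    Matrix (I → Bool) (I → Bool) ℝ :=
  Matrix.of fun x y => if hammingDist x y = 1 ∧ f x ≠ f y then (1 : ℝ) else 0

/-- Spectral sensitivity `λ(f)`: the ℓ2→ℓ2 operator norm of the adjacency matrix of the
sensitivity graph of `f`. -/
noncomputable def specSens {I : Type*} [Fintype I] [DecidableEq I] (f : (I → Bool) → Bool) : ℝ :=
  specNorm (sensAdj f)

/-- The matrix `B_q` built from `q : {0,1}^n → ℝ`: entry `(x,y)` equals `(q(x)-q(y))/2`
when `x` and `y` differ in exactly one coordinate, and `0` otherwise. -/
noncomputable def Bq {n : ℕ} (q : (Fin n → Bool) → ℝ) :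
    Matrix (Fin n → Bool) (Fin n → Bool) ℝ :=
  Matrix.of fun x y => if hammingDist x y = 1 then (q x - q y) / 2 else 0

theorem specNorm_le_of_abs_le {I : Type*} [Fintype I] [DecidableEq I] {A M : Matrix I I ℝ}
    (h : ∀ x y, |A x y| ≤ M x y) : specNorm A ≤ specNorm M := by
  refine ContinuousLinearMap.opNorm_le_bound _ (norm_nonneg _) fun v => ?_
  let w : EuclideanSpace ℝ I := WithLp.toLp 2 fun i => |v i|
  have hw : ‖w‖ = ‖v‖ := by simp [w, EuclideanSpace.norm_eq]
  rw [← hw]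
  refine le_trans ?_ ((Matrix.toEuclideanCLM (𝕜 := ℝ) M).le_opNorm w)
  rw [EuclideanSpace.norm_eq, EuclideanSpace.norm_eq]
  gcongr with x
  simp only [Matrix.ofLp_toEuclideanCLM, Matrix.mulVec, dotProduct, Real.norm_eq_abs]
  refine le_trans ?_ (le_abs_self _)
  refine (Finset.abs_sum_le_sum_abs _ _).trans (Finset.sum_le_sum fun y _ => ?_)
  rw [abs_mul]
  exact mul_le_mul_of_nonneg_right (h x y) (abs_nonneg _)

open scoped Matrix.Norms.L2Operator in
/-- Taking half the commutator with a diagonal sign matrix does not increase the norm. -/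
theorem specNorm_half_commutator_le {I : Type*} [Fintype I] [DecidableEq I] (s : I → ℝ)
    (hs : ∀ x, |s x| ≤ 1) (B : Matrix I I ℝ) :
    specNorm (Matrix.of fun x y => (s x - s y) / 2 * B x y) ≤ specNorm B := by
  have hD : ‖Matrix.diagonal s‖ ≤ 1 := by
    rw [Matrix.l2_opNorm_diagonal]
    exact (pi_norm_le_iff_of_nonneg zero_le_one).2 hs
  have e : (Matrix.of fun x y => (s x - s y) / 2 * B x y) =
      (1 / 2 : ℝ) • (Matrix.diagonal s * B - B * Matrix.diagonal s) := by
    ext x y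
    simp only [Matrix.of_apply, Matrix.smul_apply, Matrix.sub_apply, Matrix.diagonal_mul,
      Matrix.mul_diagonal, smul_eq_mul]
    ring
  change ‖(Matrix.of fun x y => (s x - s y) / 2 * B x y)‖ ≤ ‖B‖
  rw [e, norm_smul]
  have h1 : ‖Matrix.diagonal s * B‖ ≤ ‖B‖ :=
    (norm_mul_le _ _).trans (mul_le_of_le_one_left (norm_nonneg _) hD)
  have h2 : ‖B * Matrix.diagonal s‖ ≤ ‖B‖ :=
    (norm_mul_le _ _).trans (mul_le_of_le_one_right (norm_nonneg _) hD)
  have h3 := norm_sub_le (Matrix.diagonal s * B) (B * Matrix.diagonal s)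
  norm_num
  linarith

/-- If `q(x) ∈ [1-2ε, 1]` whenever `f(x) = 1` and `q(x) ∈ [-1, -1+2ε]`
whenever `f(x) = 0`, then `λ(f) ≤ ‖B_q‖ / (1 - 2ε)`. -/
theorem specSens_le_Bq (n : ℕ) (hn : 1 ≤ n) (f : (Fin n → Bool) → Bool)
    (ε : ℝ) (hε0 : 0 ≤ ε) (hε : ε < 1/2) (q : (Fin n → Bool) → ℝ)
    (hq1 : ∀ x, f x = true → q x ∈ Set.Icc (1 - 2 * ε) 1)
    (hq0 : ∀ x, f x = false → q x ∈ Set.Icc (-1) (-1 + 2 * ε)) :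
    specSens f ≤ specNorm (Bq q) / (1 - 2 * ε) := by
  have hc : 0 < 1 - 2 * ε := by linarith
  rw [le_div_iff₀ hc]
  have hsmul : specNorm ((1 - 2 * ε) • sensAdj f) = specSens f * (1 - 2 * ε) := by
    rw [specNorm, map_smul, norm_smul, Real.norm_of_nonneg hc.le, mul_comm]
    rfl
  rw [← hsmul]
  let s : (Fin n → Bool) → ℝ := fun x => if f x then 1 else -1
  have hs : ∀ x, |s x| ≤ 1 := fun x => by
    simp only [s]
    split_ifs <;> simp
  refine (specNorm_le_of_abs_le fun x y => ?_).trans (specNorm_half_commutator_le s hs (Bq q))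
  by_cases hxy : hammingDist x y = 1
  · cases hx : f x <;> cases hy : f y <;>
      simp only [sensAdj, Bq, s, hxy, hx, hy, Matrix.smul_apply, Matrix.of_apply, smul_eq_mul]
    · simp
    · have h0 := hq0 x hx
      have h1 := hq1 y hy
      norm_num [abs_of_pos hc]
      linarith [h0.2, h1.1]
    · have h0 := hq0 y hy
      have h1 := hq1 x hx
      norm_num [abs_of_pos hc]
      linarith [h0.2, h1.1]
    · simp
  · simp [sensAdj, Bq, hxy]
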